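/- arXiv:0909.5568 — 2 statements merged into one kernel-verified Lean document; each statement's English description precedes it below -/
import Mathlib

section
/- For every nonzero λ ∈ k^c and every integer 0 ≤ i ≤ a, the left ideal A u_λ^i of A has k-dimension a^{c−1}(a − i); in particular dim_k A u_λ = a^c − a^{c−1} and dim_k A u_λ^{a−1} = a^{c−1}. -/
/-- The defining relations of the homogeneous quantum complete intersection with `c`
generators `x_i`, all exponents equal to `a`, and all commutators equal to `q`:
`x_i ^ a = 0` for all `i`, and `x_i x_j = q • (x_j x_i)` for `i < j`. -/
inductive QCIRel (k : Type) [Field k] (c a : ℕ) (q : k) :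
    FreeAlgebra k (Fin c) → FreeAlgebra k (Fin c) → Prop
  | pow (i : Fin c) : QCIRel k c a q (FreeAlgebra.ι k i ^ a) 0
  | comm (i j : Fin c) (hij : i < j) :
      QCIRel k c a q (FreeAlgebra.ι k i * FreeAlgebra.ι k j)
        (q • (FreeAlgebra.ι k j * FreeAlgebra.ι k i))

/-- The homogeneous quantum complete intersection `A = k⟨x_1,…,x_c⟩/(x_i^a, x_ix_j - q x_jx_i)`. -/
abbrev QCI (k : Type) [Field k] (c a : ℕ) (q : k) : Type := RingQuot (QCIRel k c a q)

/-- The image of the generator `x_i` in `A`. -/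
noncomputable def Xgen (k : Type) [Field k] (c a : ℕ) (q : k) (i : Fin c) : QCI k c a q :=
  RingQuot.mkAlgHom k (QCIRel k c a q) (FreeAlgebra.ι k i)

/-- The element `u_λ = λ_1 x_1 + ⋯ + λ_c x_c` of `A`. -/
noncomputable def uElt (k : Type) [Field k] (c a : ℕ) (q : k) (lam : Fin c → k) :
    QCI k c a q :=
  ∑ i, lam i • Xgen k c a q i

section QBinomial

variable {k : Type*} [Field k]

/-- The Gaussian binomial coefficients, given by the `q`-Pascal recursion. -/
def gaussChoose (q : k) : ℕ → ℕ → k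
  | _, 0 => 1
  | 0, _ + 1 => 0
  | n + 1, j + 1 => gaussChoose q n j + q ^ (j + 1) * gaussChoose q n (j + 1)

lemma gaussChoose_zero_right (q : k) (n : ℕ) : gaussChoose q n 0 = 1 := by
  cases n <;> rfl

lemma gaussChoose_succ_succ (q : k) (n j : ℕ) :
    gaussChoose q (n + 1) (j + 1) =
      gaussChoose q n j + q ^ (j + 1) * gaussChoose q n (j + 1) := rfl

lemma gaussChoose_of_lt (q : k) : ∀ {n j : ℕ}, n < j → gaussChoose q n j = 0
  | 0, _ + 1, _ => rfl
  | n + 1, j + 1, h => by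
    rw [gaussChoose_succ_succ, gaussChoose_of_lt q (by omega : n < j),
      gaussChoose_of_lt q (by omega : n < j + 1)]
    simp

lemma gaussChoose_self (q : k) (n : ℕ) : gaussChoose q n n = 1 := by
  induction n with
  | zero => rfl
  | succ n ih => rw [gaussChoose_succ_succ, ih, gaussChoose_of_lt q n.lt_succ_self]; simp

lemma gaussChoose_succ_succ_mul (q : k) (n j : ℕ) :
    gaussChoose q (n + 1) (j + 1) * (q ^ (j + 1) - 1) =
      (q ^ (n + 1) - 1) * gaussChoose q n j := by
  induction n generalizing j with
  | zero =>
    cases j with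
    | zero => simp [gaussChoose]
    | succ j => simp [gaussChoose]
  | succ n ih =>
    have key : gaussChoose q (n + 1) j * (q ^ (n + 1) - q ^ j) =
        q ^ j * (q ^ (n + 1) - 1) * gaussChoose q n j := by
      cases j with
      | zero => simp [gaussChoose_zero_right]
      | succ j =>
        have h1 := ih j
        have h2 := gaussChoose_succ_succ q n j
        linear_combination (q ^ (n + 1) - 1) * h2 - h1
    have h := ih j
    rw [gaussChoose_succ_succ q (n + 1) j]
    linear_combination (-q) * key + q ^ (j + 1) * h

lemma gaussChoose_eq_zero_of_isPrimitiveRoot {q : k} {b j : ℕ} (hq : IsPrimitiveRoot q b)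
    (hj0 : j ≠ 0) (hjb : j < b) : gaussChoose q b j = 0 := by
  obtain ⟨j, rfl⟩ := Nat.exists_eq_succ_of_ne_zero hj0
  obtain ⟨b, rfl⟩ := Nat.exists_eq_succ_of_ne_zero (by omega : b ≠ 0)
  have h := gaussChoose_succ_succ_mul q b j
  rw [hq.pow_eq_one, sub_self, zero_mul] at h
  exact (mul_eq_zero.1 h).resolve_right
    (sub_ne_zero.2 (hq.pow_ne_one_of_pos_of_lt hj0 hjb))

variable {A : Type*} [Ring A] [Algebra k A]

lemma mul_pow_of_mul_eq_smul {q : k} {x y : A} (h : x * y = q • (y * x)) (n : ℕ) :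
    x * y ^ n = q ^ n • (y ^ n * x) := by
  induction n with
  | zero => simp
  | succ n ih =>
    rw [pow_succ, ← mul_assoc, ih, smul_mul_assoc, mul_assoc, h, mul_smul_comm, smul_smul,
      mul_assoc, pow_succ]

lemma pow_mul_of_mul_eq_smul {q : k} {x y : A} (h : x * y = q • (y * x)) (n : ℕ) :
    x ^ n * y = q ^ n • (y * x ^ n) := by
  induction n with
  | zero => simp
  | succ n ih =>
    rw [pow_succ, mul_assoc, h, mul_smul_comm, ← mul_assoc, ih, smul_mul_assoc, smul_smul,
      mul_assoc, pow_succ, mul_comm q]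

/-- The `q`-binomial theorem. -/
lemma add_pow_of_mul_eq_smul {q : k} {x y : A} (h : x * y = q • (y * x)) (n : ℕ) :
    (x + y) ^ n =
      ∑ p ∈ Finset.HasAntidiagonal.antidiagonal n, gaussChoose q n p.1 • (y ^ p.1 * x ^ p.2) := by
  induction n with
  | zero => simp [gaussChoose]
  | succ n ih =>
    have hx : x * ∑ p ∈ Finset.HasAntidiagonal.antidiagonal n, gaussChoose q n p.1 • (y ^ p.1 * x ^ p.2) =
        ∑ p ∈ Finset.HasAntidiagonal.antidiagonal (n + 1),
          (q ^ p.1 * gaussChoose q n p.1) • (y ^ p.1 * x ^ p.2) := by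
      rw [Finset.Nat.sum_antidiagonal_succ', Finset.mul_sum,
        gaussChoose_of_lt q n.lt_succ_self]
      simp only [mul_zero, zero_smul, zero_add]
      refine Finset.sum_congr rfl fun p _ => ?_
      rw [mul_smul_comm, ← mul_assoc, mul_pow_of_mul_eq_smul h, smul_mul_assoc, smul_smul,
        mul_assoc, ← pow_succ', mul_comm]
    rw [pow_succ', ih, add_mul, hx, Finset.Nat.sum_antidiagonal_succ,
      Finset.Nat.sum_antidiagonal_succ, Finset.mul_sum, add_assoc, ← Finset.sum_add_distrib]
    simp only [gaussChoose_zero_right, gaussChoose_succ_succ]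
    congr 1
    · simp
    · refine Finset.sum_congr rfl fun p _ => ?_
      rw [mul_smul_comm, ← mul_assoc, ← pow_succ', add_smul, add_comm]

lemma add_pow_of_isPrimitiveRoot {q : k} {b : ℕ} (hb : b ≠ 0) (hq : IsPrimitiveRoot q b)
    {x y : A} (h : x * y = q • (y * x)) : (x + y) ^ b = x ^ b + y ^ b := by
  obtain ⟨b, rfl⟩ := Nat.exists_eq_succ_of_ne_zero hb
  rw [add_pow_of_mul_eq_smul h, Nat.succ_eq_add_one, Finset.Nat.sum_antidiagonal_succ]
  simp only [gaussChoose_zero_right, pow_zero, one_mul, one_smul]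
  congr 1
  rw [Finset.sum_eq_single (b, 0)]
  · simp [gaussChoose_self]
  · rintro ⟨i, j⟩ hij hne
    rw [Finset.HasAntidiagonal.mem_antidiagonal] at hij
    have : j ≠ 0 := by
      rintro rfl
      exact hne (by simpa using hij)
    dsimp only at hij ⊢
    rw [gaussChoose_eq_zero_of_isPrimitiveRoot hq (by omega) (by omega), zero_smul]
  · simp

/-- If `a` is the order `b` of `q`, or `b` times the characteristic, then `a`-th powers are
additive on `q`-commuting pairs. -/
lemma add_pow_of_mul_eq_smul_of_eq_ite {q : k} {a b : ℕ} (ha : a ≠ 0)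
    (hb : b = if ringChar k = 0 then a else a / Nat.gcd a (ringChar k))
    (hq : IsPrimitiveRoot q b) {x y : A} (h : x * y = q • (y * x)) :
    (x + y) ^ a = x ^ a + y ^ a := by
  by_cases hab : b = a
  · exact add_pow_of_isPrimitiveRoot ha (hab ▸ hq) h
  have hp0 : ringChar k ≠ 0 := fun h0 => hab (by rw [hb, if_pos h0])
  rw [if_neg hp0] at hb
  have hp : (ringChar k).Prime :=
    (CharP.char_is_prime_or_zero k (ringChar k)).resolve_right hp0
  have hdvd : ringChar k ∣ a := by
    by_contra hd
    rw [Nat.gcd_comm, ((Nat.Prime.coprime_iff_not_dvd hp).2 hd).gcd_eq_one, Nat.div_one] at hb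
    exact hab hb
  rw [Nat.gcd_eq_right hdvd] at hb
  have hab' : a = b * ringChar k := by rw [hb, Nat.div_mul_cancel hdvd]
  have hb0 : b ≠ 0 := by
    rintro rfl
    exact ha (by rw [hab', zero_mul])
  nontriviality A
  have : Fact (ringChar k).Prime := ⟨hp⟩
  have : CharP A (ringChar k) := charP_of_injective_algebraMap (algebraMap k A).injective _
  have hcomm : Commute (x ^ b) (y ^ b) := by
    have hxy := pow_mul_of_mul_eq_smul h b
    rw [hq.pow_eq_one, one_smul] at hxy
    exact Commute.pow_right hxy b
  rw [hab', pow_mul, pow_mul, pow_mul, add_pow_of_isPrimitiveRoot hb0 hq h,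
    add_pow_char_of_commute _ hcomm]

end QBinomial

namespace QCI

section Basic

variable {k : Type} [Field k] {c a : ℕ} {q : k}

lemma Xgen_pow (i : Fin c) : Xgen k c a q i ^ a = 0 := by
  rw [Xgen, ← map_pow, RingQuot.mkAlgHom_rel k (QCIRel.pow i), map_zero]

lemma Xgen_mul_Xgen {i j : Fin c} (hij : i < j) :
    Xgen k c a q i * Xgen k c a q j = q • (Xgen k c a q j * Xgen k c a q i) := by
  simp only [Xgen]
  rw [← map_mul, RingQuot.mkAlgHom_rel k (QCIRel.comm i j hij), map_smul, map_mul]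

lemma sum_smul_Xgen_pow (ha : a ≠ 0)
    {b : ℕ} (hb : b = if ringChar k = 0 then a else a / Nat.gcd a (ringChar k))
    (hq : IsPrimitiveRoot q b) (lam : Fin c → k) (s : Finset (Fin c)) :
    (∑ i ∈ s, lam i • Xgen k c a q i) ^ a = 0 := by
  induction s using Finset.induction_on_max with
  | empty => simp [ha]
  | insert j s hj ih =>
    have hjs : j ∉ s := fun h => lt_irrefl _ (hj j h)
    rw [Finset.sum_insert hjs, add_comm, add_pow_of_mul_eq_smul_of_eq_ite ha hb hq, ih,
      smul_pow, Xgen_pow, smul_zero, add_zero]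
    rw [Finset.sum_mul, Finset.mul_sum, Finset.smul_sum]
    refine Finset.sum_congr rfl fun i hi => ?_
    rw [smul_mul_smul_comm, smul_mul_smul_comm, Xgen_mul_Xgen (hj i hi), smul_comm q,
      mul_comm (lam i)]

lemma uElt_pow (ha : a ≠ 0)
    {b : ℕ} (hb : b = if ringChar k = 0 then a else a / Nat.gcd a (ringChar k))
    (hq : IsPrimitiveRoot q b) (lam : Fin c → k) : uElt k c a q lam ^ a = 0 :=
  sum_smul_Xgen_pow ha hb hq lam Finset.univ

/-- A subspace containing `1` and stable under left multiplication by the generators is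
everything. -/
lemma eq_top_of_one_mem {N : Submodule k (QCI k c a q)} (h1 : 1 ∈ N)
    (hN : ∀ i, ∀ w ∈ N, Xgen k c a q i * w ∈ N) : N = ⊤ := by
  have key : ∀ z : FreeAlgebra k (Fin c), ∀ w ∈ N,
      RingQuot.mkAlgHom k (QCIRel k c a q) z * w ∈ N := by
    intro z
    induction z using FreeAlgebra.induction with
    | grade0 r =>
      intro w hw
      rw [AlgHom.commutes, ← Algebra.smul_def]
      exact N.smul_mem r hw
    | grade1 i => exact hN i
    | mul x y hx hy =>
      intro w hw
      rw [map_mul, mul_assoc]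
      exact hx _ (hy _ hw)
    | add x y hx hy =>
      intro w hw
      rw [map_add, add_mul]
      exact N.add_mem (hx _ hw) (hy _ hw)
  refine eq_top_iff.2 fun z _ => ?_
  obtain ⟨z, rfl⟩ := RingQuot.mkAlgHom_surjective k (QCIRel k c a q) z
  simpa using key z 1 h1

end Basic

section Representation

variable {k : Type} [Field k] {c : ℕ} (a : ℕ) (q : k)

/-- The action of `x_i` on the space with basis the monomials `x^m`, `m : Fin c → ℕ`. -/
noncomputable def shift (i : Fin c) : Module.End k ((Fin c → ℕ) →₀ k) :=
  Finsupp.linearCombination k fun m =>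
    if m i + 1 < a then
      Finsupp.single (m + Pi.single i 1) (q ^ ∑ l ∈ Finset.Ioi i, m l)
    else 0

lemma shift_single (i : Fin c) (m : Fin c → ℕ) (r : k) :
    shift a q i (Finsupp.single m r) =
      if m i + 1 < a then
        Finsupp.single (m + Pi.single i 1) (r * q ^ ∑ l ∈ Finset.Ioi i, m l)
      else 0 := by
  rw [shift, Finsupp.linearCombination_single]
  split_ifs <;> simp

lemma shift_pow_succ_single (i : Fin c) (n : ℕ) (m : Fin c → ℕ) (r : k)
    (h : a ≤ m i + n + 1) : (shift a q i ^ (n + 1)) (Finsupp.single m r) = 0 := by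
  induction n generalizing m r with
  | zero => rw [zero_add, pow_one, shift_single, if_neg (by omega)]
  | succ n ih =>
    rw [pow_succ, Module.End.mul_apply, shift_single]
    split_ifs
    · exact ih _ _ (by simp; omega)
    · simp

lemma shift_pow (ha : a ≠ 0) (i : Fin c) : shift a q i ^ a = 0 := by
  obtain ⟨a, rfl⟩ := Nat.exists_eq_succ_of_ne_zero ha
  refine Finsupp.lhom_ext fun m r => ?_
  exact shift_pow_succ_single _ q i a m r (by omega)

lemma shift_mul_shift {i j : Fin c} (hij : i < j) :
    shift a q i * shift a q j = q • (shift a q j * shift a q i) := by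
  refine Finsupp.lhom_ext fun m r => ?_
  have h1 : ∑ l ∈ Finset.Ioi i, (m + Pi.single j 1 : Fin c → ℕ) l =
      (∑ l ∈ Finset.Ioi i, m l) + 1 := by
    simp only [Pi.add_apply, Finset.sum_add_distrib]
    rw [Finset.sum_pi_single']
    simp [hij]
  have h2 : ∑ l ∈ Finset.Ioi j, (m + Pi.single i 1 : Fin c → ℕ) l =
      ∑ l ∈ Finset.Ioi j, m l := by
    simp only [Pi.add_apply, Finset.sum_add_distrib]
    rw [Finset.sum_pi_single']
    simp [hij.le]
  have h3 : (m + Pi.single j 1 : Fin c → ℕ) i = m i := by simp [hij.ne]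
  have h4 : (m + Pi.single i 1 : Fin c → ℕ) j = m j := by simp [hij.ne']
  rw [LinearMap.smul_apply, Module.End.mul_apply, Module.End.mul_apply, shift_single,
    shift_single]
  split_ifs with hj hi hi
  · rw [shift_single, shift_single, h1, h2, h3, h4, if_pos hi, if_pos hj, Finsupp.smul_single,
      add_right_comm, smul_eq_mul]
    congr 1
    ring
  · rw [shift_single, h3, if_neg hi]
    simp
  · rw [shift_single, h4, if_neg hj]
    simp
  · simp

/-- The representation of `A` on the span of the monomials. -/
noncomputable def rep (ha : a ≠ 0) : QCI k c a q →ₐ[k] Module.End k ((Fin c → ℕ) →₀ k) :=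
  RingQuot.liftAlgHom k ⟨FreeAlgebra.lift k (shift a q), by
    rintro x y (i | ⟨i, j, hij⟩)
    · simp [shift_pow a q ha]
    · simp [shift_mul_shift a q hij]⟩

lemma rep_Xgen (ha : a ≠ 0) (i : Fin c) : rep a q ha (Xgen k c a q i) = shift a q i := by
  rw [rep, Xgen, RingQuot.liftAlgHom_mkAlgHom_apply, FreeAlgebra.lift_ι_apply]

lemma single_mem_range_rep (ha : a ≠ 0) (hq : q ≠ 0) (n : ℕ) (m : Fin c → ℕ)
    (hm : ∀ i, m i < a) (hn : ∑ i, m i = n) (r : k) :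
    ∃ z, rep a q ha z (Finsupp.single 0 1) = Finsupp.single m r := by
  induction n generalizing m r with
  | zero =>
    have : m = 0 := by
      funext i
      exact Finset.sum_eq_zero_iff.1 hn i (Finset.mem_univ i)
    exact ⟨algebraMap k _ r, by simp [this, Module.algebraMap_end_apply]⟩
  | succ n ih =>
    obtain ⟨i, hi⟩ : ∃ i, m i ≠ 0 := by
      by_contra! h
      simp [h] at hn
    obtain ⟨m', rfl⟩ : ∃ m' : Fin c → ℕ, m = m' + Pi.single i 1 := by
      refine ⟨m - Pi.single i 1, ?_⟩
      funext l
      rcases eq_or_ne l i with rfl | hl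
      · simp; omega
      · simp [hl]
    have hsum : ∑ l, m' l = n := by
      simp only [Pi.add_apply, Finset.sum_add_distrib] at hn
      rw [Finset.sum_pi_single'] at hn
      simpa using hn
    obtain ⟨z, hz⟩ := ih m' (fun l => (Nat.le_add_right _ _).trans_lt (hm l)) hsum
      (r * (q ^ ∑ l ∈ Finset.Ioi i, m' l)⁻¹)
    refine ⟨Xgen k c a q i * z, ?_⟩
    have hlt : m' i + 1 < a := by simpa using hm i
    rw [map_mul, Module.End.mul_apply, hz, rep_Xgen, shift_single, if_pos hlt, mul_assoc,
      inv_mul_cancel₀ (pow_ne_zero _ hq), mul_one]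

lemma pow_le_finrank (ha : a ≠ 0) (hq : q ≠ 0) [Module.Finite k (QCI k c a q)] :
    a ^ c ≤ Module.finrank k (QCI k c a q) := by
  choose z hz using fun m : Fin c → Fin a =>
    single_mem_range_rep a q ha hq _ (fun i => (m i : ℕ)) (fun i => (m i).2) rfl 1
  have hli : LinearIndependent k z := by
    refine LinearIndependent.of_comp
      ((LinearMap.applyₗ (Finsupp.single 0 1)).comp (rep a q ha).toLinearMap) ?_
    have : (fun m : Fin c → Fin a =>
        (Finsupp.single (fun i => (m i : ℕ)) 1 : (Fin c → ℕ) →₀ k)) =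
        ((LinearMap.applyₗ (Finsupp.single 0 1)).comp (rep a q ha).toLinearMap) ∘ z := by
      funext m
      exact (hz m).symm
    rw [← this]
    refine (Finsupp.linearIndependent_single_one k (Fin c → ℕ)).comp
      (fun m : Fin c → Fin a => fun i => (m i : ℕ)) fun m m' h => ?_
    funext i
    exact Fin.ext (congrFun h i)
  simpa using hli.fintype_card_le_finrank

end Representation

section Span

variable {k A : Type*} [Field k] [Ring A] [Algebra k A]

/-- The subspace `W` has a spanning set with at most `n` elements. -/
def SpannedBy (n : ℕ) (W : Submodule k A) : Prop :=
  ∃ T : Finset A, T.card ≤ n ∧ Submodule.span k (T : Set A) = W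

lemma SpannedBy.finite {n : ℕ} {W : Submodule k A} (h : SpannedBy n W) : Module.Finite k W := by
  obtain ⟨T, -, rfl⟩ := h
  infer_instance

lemma SpannedBy.finrank_le {n : ℕ} {W : Submodule k A} (h : SpannedBy n W) :
    Module.finrank k W ≤ n := by
  obtain ⟨T, hT, rfl⟩ := h
  exact (finrank_span_finset_le_card T).trans hT

open scoped Pointwise in
lemma SpannedBy.mul {m n : ℕ} {V W : Submodule k A} (hV : SpannedBy m V) (hW : SpannedBy n W) :
    SpannedBy (m * n) (V * W) := by
  classical
  obtain ⟨S, hS, rfl⟩ := hV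
  obtain ⟨T, hT, rfl⟩ := hW
  exact ⟨S * T, Finset.card_mul_le.trans (Nat.mul_le_mul hS hT), by
    rw [Submodule.span_mul_span, Finset.coe_mul]⟩

lemma spannedBy_span_singleton (x : A) : SpannedBy 1 (Submodule.span k {x}) :=
  ⟨{x}, by simp, by simp⟩

lemma spannedBy_one : SpannedBy 1 (1 : Submodule k A) := by
  rw [Submodule.one_eq_span]
  exact spannedBy_span_singleton 1

lemma SpannedBy.pow {W : Submodule k A} (h : SpannedBy 1 W) (n : ℕ) : SpannedBy 1 (W ^ n) := by
  induction n with
  | zero => simpa using spannedBy_one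
  | succ n ih => simpa [pow_succ] using ih.mul h

lemma SpannedBy.add {m n : ℕ} {V W : Submodule k A} (hV : SpannedBy m V) (hW : SpannedBy n W) :
    SpannedBy (m + n) (V + W) := by
  classical
  obtain ⟨S, hS, rfl⟩ := hV
  obtain ⟨T, hT, rfl⟩ := hW
  exact ⟨S ∪ T, (Finset.card_union_le _ _).trans (Nat.add_le_add hS hT), by
    rw [Finset.coe_union, Submodule.span_union, Submodule.add_eq_sup]⟩

lemma SpannedBy.sum_pow {W : Submodule k A} (h : SpannedBy 1 W) (n : ℕ) :
    SpannedBy n (∑ i ∈ Finset.range n, W ^ i) := by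
  induction n with
  | zero => exact ⟨∅, by simp, by simp⟩
  | succ n ih => simpa [Finset.sum_range_succ] using ih.add (h.pow n)

lemma SpannedBy.list_prod {n : ℕ} (l : List (Submodule k A)) (h : ∀ W ∈ l, SpannedBy n W) :
    SpannedBy (n ^ l.length) l.prod := by
  induction l with
  | nil => simpa using spannedBy_one
  | cons W l ih =>
    rw [List.prod_cons, List.length_cons, pow_succ']
    exact (h W (by simp)).mul (ih fun V hV => h V (by simp [hV]))

end Span

section Ideals

variable (k : Type) [Field k] {c : ℕ} (a : ℕ) (q : k)

/-- The line spanned by `x_i`. -/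
noncomputable def line (i : Fin c) : Submodule k (QCI k c a q) :=
  Submodule.span k {Xgen k c a q i}

/-- The span of the powers of `x_i`. -/
noncomputable def powers (i : Fin c) : Submodule k (QCI k c a q) :=
  ∑ n ∈ Finset.range a, line k a q i ^ n

/-- The span of the ordered monomials in the `x_i` with `i ∈ l`. -/
noncomputable def monomials (l : List (Fin c)) : Submodule k (QCI k c a q) :=
  (l.map (powers k a q)).prod

variable {k a q}

lemma commute_line_line (hq : q ≠ 0) (i j : Fin c) :
    Commute (line k a q i) (line k a q j) := by
  have key : ∀ i j : Fin c, i < j → Commute (line k a q i) (line k a q j) := by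
    intro i j hij
    rw [Commute, SemiconjBy, line, line, Submodule.span_mul_span, Submodule.span_mul_span,
      Set.singleton_mul_singleton, Set.singleton_mul_singleton, Xgen_mul_Xgen hij,
      Submodule.span_singleton_smul_eq hq.isUnit]
  rcases lt_trichotomy i j with h | rfl | h
  · exact key i j h
  · exact Commute.refl _
  · exact (key j i h).symm

lemma commute_line_powers (hq : q ≠ 0) (i j : Fin c) :
    Commute (line k a q i) (powers k a q j) :=
  Commute.sum_right _ _ _ fun n _ => (commute_line_line hq i j).pow_right n

lemma commute_line_monomials (hq : q ≠ 0) (i : Fin c) (l : List (Fin c)) :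
    Commute (line k a q i) (monomials k a q l) := by
  refine Commute.list_prod_right _ _ fun W hW => ?_
  obtain ⟨j, -, rfl⟩ := List.mem_map.1 hW
  exact commute_line_powers hq i j

lemma line_mul_powers_le (i : Fin c) :
    line k a q i * powers k a q i ≤ powers k a q i := by
  have h0 : line k a q i ^ a = 0 := by
    rw [line, Submodule.span_pow, Set.singleton_pow, Xgen_pow, Submodule.span_zero_singleton,
      Submodule.zero_eq_bot]
  have h : line k a q i * powers k a q i + 1 = powers k a q i := by
    calc line k a q i * powers k a q i + 1
        = ∑ n ∈ Finset.range (a + 1), line k a q i ^ n := by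
          rw [Finset.sum_range_succ', powers, Finset.mul_sum]
          simp only [pow_succ', pow_zero]
      _ = powers k a q i := by rw [Finset.sum_range_succ, h0, add_zero, powers]
  exact le_of_le_of_eq le_sup_left h

lemma line_mul_monomials_le (hq : q ≠ 0) {i : Fin c} {l : List (Fin c)} (hi : i ∈ l) :
    line k a q i * monomials k a q l ≤ monomials k a q l := by
  induction l with
  | nil => simp at hi
  | cons j l ih =>
    have hcons : monomials k a q (j :: l) = powers k a q j * monomials k a q l := by
      simp [monomials]
    rw [hcons]
    rcases eq_or_ne i j with rfl | hij
    · rw [← mul_assoc]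
      exact mul_le_mul' (line_mul_powers_le i) le_rfl
    · rw [← mul_assoc, (commute_line_powers hq i j).eq, mul_assoc]
      exact mul_le_mul' le_rfl (ih ((List.mem_cons.1 hi).resolve_left hij))

lemma one_le_monomials (ha : a ≠ 0) (l : List (Fin c)) : 1 ≤ monomials k a q l := by
  induction l with
  | nil => simp [monomials]
  | cons j l ih =>
    have hcons : monomials k a q (j :: l) = powers k a q j * monomials k a q l := by
      simp [monomials]
    have h1 : 1 ≤ powers k a q j := by
      obtain ⟨a, rfl⟩ := Nat.exists_eq_succ_of_ne_zero ha
      rw [powers, Nat.succ_eq_add_one, Finset.sum_range_succ', pow_zero]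
      exact le_sup_right
    rw [hcons, ← one_mul (1 : Submodule k (QCI k c a q))]
    exact mul_le_mul' h1 ih

lemma spannedBy_monomials (l : List (Fin c)) :
    SpannedBy (a ^ l.length) (monomials k a q l) := by
  have := SpannedBy.list_prod (n := a) (l.map (powers k a q)) fun W hW => by
    obtain ⟨j, -, rfl⟩ := List.mem_map.1 hW
    exact (spannedBy_span_singleton _).sum_pow a
  rwa [List.length_map] at this

lemma eq_top_of_line_mul_le {N : Submodule k (QCI k c a q)} (h1 : 1 ≤ N)
    (hN : ∀ i, line k a q i * N ≤ N) : N = ⊤ :=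
  eq_top_of_one_mem (Submodule.one_le.1 h1) fun i _ hw =>
    hN i (Submodule.mul_mem_mul (Submodule.mem_span_singleton_self _) hw)

lemma module_finite (ha : a ≠ 0) (hq : q ≠ 0) : Module.Finite k (QCI k c a q) := by
  have htop : monomials k a q (Finset.univ : Finset (Fin c)).toList = ⊤ :=
    eq_top_of_line_mul_le (one_le_monomials ha _) fun i =>
      line_mul_monomials_le hq (by simp)
  have := (spannedBy_monomials (k := k) (a := a) (q := q)
    (Finset.univ : Finset (Fin c)).toList).finite
  rw [htop] at this
  exact Module.Finite.equiv Submodule.topEquiv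

/-- `A` is generated, modulo `A u_λ`, by the monomials not involving `x_m`, if `λ_m ≠ 0`. -/
lemma monomials_add_top_mul_span_uElt (ha : a ≠ 0) (hq : q ≠ 0) {lam : Fin c → k} {m : Fin c}
    (hm : lam m ≠ 0) :
    monomials k a q (Finset.univ.erase m).toList +
      ⊤ * Submodule.span k {uElt k c a q lam} = ⊤ := by
  set W := monomials k a q (Finset.univ.erase m).toList with hW
  set U := Submodule.span k {uElt k c a q lam} with hU
  have hWi : ∀ i, i ≠ m → line k a q i * W ≤ W := fun i hi =>
    line_mul_monomials_le hq (by simp [hi])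
  have hline : line k a q m ≤ U + ∑ i ∈ Finset.univ.erase m, line k a q i := by
    rw [line, Submodule.span_singleton_le_iff_mem]
    have hx : Xgen k c a q m = (lam m)⁻¹ • uElt k c a q lam +
        ∑ i ∈ Finset.univ.erase m, (-((lam m)⁻¹ * lam i)) • Xgen k c a q i := by
      rw [uElt, ← Finset.add_sum_erase _ _ (Finset.mem_univ m), smul_add, smul_smul,
        inv_mul_cancel₀ hm, one_smul, add_assoc, Finset.smul_sum, ← Finset.sum_add_distrib]
      rw [left_eq_add]
      exact Finset.sum_eq_zero fun i _ => by
        rw [smul_smul, ← add_smul, add_neg_cancel, zero_smul]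
    rw [hx]
    refine Submodule.add_mem_sup
      (U.smul_mem _ (Submodule.mem_span_singleton_self _)) ?_
    refine Submodule.sum_mem _ fun i hi => ?_
    refine (Finset.single_le_sum (f := line k a q) (fun _ _ => bot_le) hi :
      line k a q i ≤ _) ?_
    exact Submodule.smul_mem _ _ (Submodule.mem_span_singleton_self _)
  refine eq_top_of_line_mul_le ((one_le_monomials ha _).trans le_sup_left) fun i => ?_
  have hTU : line k a q i * (⊤ * U) ≤ ⊤ * U := by
    rw [← mul_assoc]
    exact mul_le_mul' le_top le_rfl
  rw [mul_add]
  refine sup_le ?_ (hTU.trans le_sup_right)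
  rcases eq_or_ne i m with rfl | hi
  · rw [(commute_line_monomials hq i _).eq]
    refine (mul_le_mul' le_rfl hline).trans ?_
    rw [mul_add, Finset.mul_sum]
    refine sup_le ((mul_le_mul' le_top le_rfl).trans le_sup_right) ?_
    refine le_trans ?_ le_sup_left
    refine Finset.sum_induction _ (· ≤ W) (fun _ _ h h' => sup_le h h') bot_le fun j hj => ?_
    rw [← hW, ← (commute_line_monomials hq j _).eq]
    exact hWi j (Finset.ne_of_mem_erase hj)
  · exact (hWi i hi).trans le_sup_left

lemma finrank_top_mul_span_uElt_pow_le (ha : a ≠ 0) (hq : q ≠ 0) {lam : Fin c → k}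
    (hlam : lam ≠ 0) (i : ℕ) :
    Module.finrank k ↥(⊤ * Submodule.span k {uElt k c a q lam} ^ i) ≤
      a ^ (c - 1) +
        Module.finrank k ↥(⊤ * Submodule.span k {uElt k c a q lam} ^ (i + 1)) := by
  have := module_finite (c := c) ha hq
  obtain ⟨m, hm⟩ := Function.ne_iff.1 hlam
  have hW := (spannedBy_monomials (k := k) (a := a) (q := q) (Finset.univ.erase m).toList).mul
    ((spannedBy_span_singleton (uElt k c a q lam)).pow i)
  have hlen : (Finset.univ.erase m).toList.length = c - 1 := by simp
  rw [hlen, mul_one] at hW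
  have htop := monomials_add_top_mul_span_uElt ha hq hm
  conv_lhs => rw [← htop, add_mul, mul_assoc, ← pow_succ']
  exact (Submodule.finrank_add_le_finrank_add_finrank _ _).trans
    (Nat.add_le_add_right hW.finrank_le _)

theorem finrank_top_mul_span_uElt_pow (ha : a ≠ 0) {b : ℕ}
    (hb : b = if ringChar k = 0 then a else a / Nat.gcd a (ringChar k))
    (hqb : IsPrimitiveRoot q b) (hq : q ≠ 0) {lam : Fin c → k} (hlam : lam ≠ 0)
    {i : ℕ} (hi : i ≤ a) :
    Module.finrank k ↥(⊤ * Submodule.span k {uElt k c a q lam} ^ i) =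
      a ^ (c - 1) * (a - i) := by
  have := module_finite (c := c) ha hq
  obtain ⟨m, -⟩ := Function.ne_iff.1 hlam
  set d : ℕ → ℕ := fun i =>
    Module.finrank k ↥(⊤ * Submodule.span k {uElt k c a q lam} ^ i) with hd
  have hstep : ∀ i, d i ≤ a ^ (c - 1) + d (i + 1) :=
    finrank_top_mul_span_uElt_pow_le ha hq hlam
  have hda : d a = 0 := by
    simp only [hd]
    rw [Submodule.span_pow, Set.singleton_pow, uElt_pow ha hb hqb,
      Submodule.span_zero_singleton, Submodule.mul_bot, finrank_bot]
  have hd0 : a ^ (c - 1) * a ≤ d 0 := by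
    simp only [hd]
    rw [pow_zero, mul_one, finrank_top, ← pow_succ, Nat.sub_add_cancel (Fin.pos m)]
    exact pow_le_finrank a q ha hq
  have hup : ∀ n ≤ a, d (a - n) ≤ a ^ (c - 1) * n := by
    intro n hn
    induction n with
    | zero => simp [hda]
    | succ n ih =>
      have h := hstep (a - (n + 1))
      rw [show a - (n + 1) + 1 = a - n by omega] at h
      have := ih (by omega)
      rw [mul_add_one]
      omega
  have hlow : ∀ n, d 0 ≤ a ^ (c - 1) * n + d n := by
    intro n
    induction n with
    | zero => simp
    | succ n ih =>
      have := hstep n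
      rw [mul_add_one]
      omega
  have h1 := hup (a - i) (Nat.sub_le _ _)
  rw [Nat.sub_sub_self hi] at h1
  have h2 := hlow i
  have h3 : a ^ (c - 1) * a = a ^ (c - 1) * i + a ^ (c - 1) * (a - i) := by
    rw [← mul_add, Nat.add_sub_cancel' hi]
  change d i = _
  omega

lemma range_toSpanSingleton_restrictScalars (x : QCI k c a q) :
    (LinearMap.range (LinearMap.toSpanSingleton (QCI k c a q) (QCI k c a q) x)).restrictScalars k =
      ⊤ * Submodule.span k {x} := by
  ext y
  simp [Submodule.mem_mul_span_singleton]

end Ideals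

end QCI

/-- for every nonzero `λ ∈ k^c` and every `0 ≤ i ≤ a`, the left ideal
`A u_λ^i` (the range of right multiplication by `u_λ^i`, an `A`-linear map) has
`k`-dimension `a^{c-1}(a - i)`; in particular `dim_k A u_λ = a^c - a^{c-1}` and
`dim_k A u_λ^{a-1} = a^{c-1}`. -/
theorem statement6 (k : Type) [Field k] [IsAlgClosed k] (c a : ℕ) (hc : 2 ≤ c) (ha : 2 ≤ a)
    (b : ℕ) (hb : b = if ringChar k = 0 then a else a / Nat.gcd a (ringChar k))
    (q : k) (hq : IsPrimitiveRoot q b) (lam : Fin c → k) (hlam : lam ≠ 0) :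
    (∀ i : ℕ, i ≤ a →
      Module.finrank k (LinearMap.range
        (LinearMap.toSpanSingleton (QCI k c a q) (QCI k c a q) (uElt k c a q lam ^ i))) =
        a ^ (c - 1) * (a - i)) ∧
    Module.finrank k (LinearMap.range
      (LinearMap.toSpanSingleton (QCI k c a q) (QCI k c a q) (uElt k c a q lam))) =
      a ^ c - a ^ (c - 1) ∧
    Module.finrank k (LinearMap.range
      (LinearMap.toSpanSingleton (QCI k c a q) (QCI k c a q) (uElt k c a q lam ^ (a - 1)))) =
      a ^ (c - 1) := by
  have ha0 : a ≠ 0 := by omega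
  have hq0 : q ≠ 0 := by
    refine hq.ne_zero ?_
    rw [hb]
    split_ifs with h
    · exact ha0
    · exact (Nat.div_pos (Nat.gcd_le_left _ (by omega)) (Nat.gcd_pos_of_pos_left _ (by omega))).ne'
  have main : ∀ i : ℕ, i ≤ a →
      Module.finrank k (LinearMap.range
        (LinearMap.toSpanSingleton (QCI k c a q) (QCI k c a q) (uElt k c a q lam ^ i))) =
        a ^ (c - 1) * (a - i) := by
    intro i hi
    rw [← QCI.finrank_top_mul_span_uElt_pow ha0 hb hq hq0 hlam hi, Submodule.span_pow,
      Set.singleton_pow, ← QCI.range_toSpanSingleton_restrictScalars]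
    rfl
  refine ⟨main, ?_, ?_⟩
  · have h := main 1 (by omega)
    rw [pow_one] at h
    rw [h, Nat.mul_sub, mul_one, ← pow_succ, Nat.sub_add_cancel (by omega)]
  · rw [main (a - 1) (Nat.sub_le _ _), Nat.sub_sub_self (by omega), mul_one]
end

section
/- For every nonzero λ ∈ k^c and every integer 0 ≤ i ≤ a, the left annihilator of u_λ^i in A equals the left ideal generated by u_λ^{a−i}: {x ∈ A : x u_λ^i = 0} = A u_λ^{a−i}. In particular {x ∈ A : x u_λ = 0} = A u_λ^{a−1} and {x ∈ A : x u_λ^{a−1} = 0} = A u_λ, so the left A-module A u_λ admits a periodic projective resolution of period 2 with all terms equal to A. -/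
/-- The Gaussian binomial coefficient `[i + j choose i]` at `q`, indexed by the pair `(i, j)`. -/
def gaussCoeff {k : Type*} [Field k] (q : k) : ℕ → ℕ → k
  | 0, _ => 1
  | _ + 1, 0 => 1
  | i + 1, j + 1 => gaussCoeff q i (j + 1) + q ^ (i + 1) * gaussCoeff q (i + 1) j
  termination_by i j => i + j

section GaussCoeff

variable {k : Type*} [Field k] (q : k)

lemma gaussCoeff_zero_left (j : ℕ) : gaussCoeff q 0 j = 1 := by
  rw [gaussCoeff]

lemma gaussCoeff_zero_right (i : ℕ) : gaussCoeff q i 0 = 1 := by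
  cases i <;> rw [gaussCoeff]

lemma gaussCoeff_succ_succ (i j : ℕ) :
    gaussCoeff q (i + 1) (j + 1) =
      gaussCoeff q i (j + 1) + q ^ (i + 1) * gaussCoeff q (i + 1) j := by
  rw [gaussCoeff]

lemma gaussCoeff_absorption (i j : ℕ) :
    (1 - q ^ (i + 1)) * gaussCoeff q (i + 1) j = (1 - q ^ (i + j + 1)) * gaussCoeff q i j ∧
    (1 - q ^ (j + 1)) * gaussCoeff q i (j + 1) = (1 - q ^ (i + j + 1)) * gaussCoeff q i j := by
  induction h : i + j generalizing i j with
  | zero =>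
    obtain ⟨rfl, rfl⟩ : i = 0 ∧ j = 0 := by omega
    simp [gaussCoeff_zero_left, gaussCoeff_zero_right]
  | succ n ih =>
    have right : (1 - q ^ (j + 1)) * gaussCoeff q i (j + 1) =
        (1 - q ^ (n + 1 + 1)) * gaussCoeff q i j := by
      cases i with
      | zero =>
        obtain rfl : j = n + 1 := by omega
        simp [gaussCoeff_zero_left]
      | succ i =>
        have hn : i + j = n := by omega
        obtain ⟨h1, h2⟩ := ih i j hn
        rw [gaussCoeff_succ_succ]
        subst hn
        linear_combination h2 - h1
    refine ⟨?_, right⟩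
    cases j with
    | zero =>
      obtain rfl : i = n + 1 := by omega
      simp [gaussCoeff_zero_right]
    | succ j =>
      have hn : i + j = n := by omega
      obtain ⟨h1, h2⟩ := ih i j hn
      rw [gaussCoeff_succ_succ]
      subst hn
      linear_combination q ^ (i + 1) * h1 - q ^ (i + 1) * h2

lemma gaussCoeff_eq_zero {b : ℕ} (hq : IsPrimitiveRoot q b) {i j : ℕ} (hi : i ≠ 0) (hj : j ≠ 0)
    (hij : i + j = b) : gaussCoeff q i j = 0 := by
  obtain ⟨i, rfl⟩ := Nat.exists_eq_succ_of_ne_zero hi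
  have h := (gaussCoeff_absorption q i j).1
  have hb : i + j + 1 = b := by omega
  rw [hb, hq.pow_eq_one, sub_self, zero_mul] at h
  refine (mul_eq_zero.mp h).resolve_left fun h0 => ?_
  exact hq.pow_ne_one_of_pos_of_lt (l := i + 1) (by omega) (by omega) (sub_eq_zero.mp h0).symm

variable {R : Type*} [Ring R] [Algebra k R] {q}

lemma mul_pow_of_qcomm {x y : R} (h : x * y = q • (y * x)) (n : ℕ) :
    x * y ^ n = q ^ n • (y ^ n * x) := by
  induction n with
  | zero => simp
  | succ n ih =>
    rw [pow_succ, ← mul_assoc, ih, smul_mul_assoc, mul_assoc, h, mul_smul_comm, smul_smul,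
      ← mul_assoc, pow_succ]

lemma pow_mul_of_qcomm {x y : R} (h : x * y = q • (y * x)) (n : ℕ) :
    x ^ n * y = q ^ n • (y * x ^ n) := by
  induction n with
  | zero => simp
  | succ n ih =>
    rw [pow_succ', mul_assoc, ih, mul_smul_comm, ← mul_assoc, h, smul_mul_assoc, smul_smul,
      mul_assoc, pow_succ]

/-- The noncommutative `q`-binomial formula. -/
lemma add_pow_of_qcomm {x y : R} (h : x * y = q • (y * x)) (n : ℕ) :
    (x + y) ^ n =
      ∑ p ∈ Finset.HasAntidiagonal.antidiagonal n, gaussCoeff q p.1 p.2 • (y ^ p.1 * x ^ p.2) := by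
  induction n with
  | zero => simp [gaussCoeff_zero_left]
  | succ n ih =>
    let g₁ : ℕ → ℕ → k := fun i j => Nat.casesOn i 0 fun i => gaussCoeff q i j
    let g₂ : ℕ → ℕ → k := fun i j => Nat.casesOn j 0 fun j => q ^ i * gaussCoeff q i j
    have hg : ∀ p ∈ Finset.HasAntidiagonal.antidiagonal (n + 1),
        gaussCoeff q p.1 p.2 • (y ^ p.1 * x ^ p.2) =
          g₁ p.1 p.2 • (y ^ p.1 * x ^ p.2) + g₂ p.1 p.2 • (y ^ p.1 * x ^ p.2) := by
      rintro ⟨i, j⟩ hp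
      rw [← add_smul]
      congr 1
      rw [Finset.HasAntidiagonal.mem_antidiagonal] at hp
      rcases i with _ | i <;> rcases j with _ | j
      · simp at hp
      · simp [g₁, g₂, gaussCoeff_zero_left]
      · simp [g₁, g₂, gaussCoeff_zero_right]
      · simp [g₁, g₂, gaussCoeff_succ_succ]
    rw [Finset.sum_congr rfl hg, Finset.sum_add_distrib, Finset.Nat.sum_antidiagonal_succ,
      Finset.Nat.sum_antidiagonal_succ', pow_succ', ih, add_mul, add_comm (x * _),
      Finset.mul_sum, Finset.mul_sum]
    have hg₁ : g₁ 0 (n + 1) = 0 := rfl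
    have hg₂ : g₂ (n + 1) 0 = 0 := rfl
    rw [hg₁, hg₂, zero_smul, zero_smul, zero_add, zero_add]
    congr 1
    · refine Finset.sum_congr rfl fun p _ => ?_
      rw [mul_smul_comm, ← mul_assoc, ← pow_succ']
    · refine Finset.sum_congr rfl fun p _ => ?_
      rw [mul_smul_comm, ← mul_assoc, mul_pow_of_qcomm h, smul_mul_assoc, smul_smul, mul_assoc,
        ← pow_succ', mul_comm]

lemma add_pow_of_qcomm_of_primitive {b : ℕ} (hb : b ≠ 0) (hq : IsPrimitiveRoot q b) {x y : R}
    (h : x * y = q • (y * x)) : (x + y) ^ b = x ^ b + y ^ b := by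
  obtain ⟨n, rfl⟩ := Nat.exists_eq_succ_of_ne_zero hb
  rw [add_pow_of_qcomm h, Finset.Nat.sum_antidiagonal_succ]
  congr 1
  · simp [gaussCoeff_zero_left]
  · rw [Finset.sum_eq_single (n, 0)]
    · simp [gaussCoeff_zero_right]
    · rintro ⟨i, j⟩ hp hne
      rw [Finset.HasAntidiagonal.mem_antidiagonal] at hp
      have hj : j ≠ 0 := by
        rintro rfl
        exact hne (by simpa using hp)
      dsimp only at hp ⊢
      rw [gaussCoeff_eq_zero q hq (by omega) hj (by omega), zero_smul]
    · simp

lemma sum_pow_of_qcomm {ι : Type*} [LinearOrder ι] {n : ℕ} (hn : n ≠ 0)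
    (hadd : ∀ x y : R, x * y = q • (y * x) → (x + y) ^ n = x ^ n + y ^ n)
    (v : ι → R) (hv : ∀ i j, i < j → v i * v j = q • (v j * v i)) (s : Finset ι) :
    (∑ i ∈ s, v i) ^ n = ∑ i ∈ s, v i ^ n := by
  induction s using Finset.induction_on_max with
  | empty => simp [hn]
  | insert m s hs ih =>
    have hm : m ∉ s := fun h => lt_irrefl _ (hs m h)
    rw [Finset.sum_insert hm, Finset.sum_insert hm, add_comm, hadd, ih, add_comm]
    rw [Finset.sum_mul, Finset.mul_sum, Finset.smul_sum]
    exact Finset.sum_congr rfl fun i hi => hv i m (hs i hi)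

lemma sum_pow_eq_zero_of_qcomm {ι : Type*} [LinearOrder ι] [Fintype ι] {a b : ℕ} (ha : 2 ≤ a)
    (hb : b = if ringChar k = 0 then a else a / Nat.gcd a (ringChar k))
    (hq : IsPrimitiveRoot q b) (v : ι → R)
    (hv : ∀ i j, i < j → v i * v j = q • (v j * v i)) (hva : ∀ i, v i ^ a = 0) :
    (∑ i, v i) ^ a = 0 := by
  have primitive : b = a → (∑ i, v i) ^ a = 0 := by
    rintro rfl
    rw [sum_pow_of_qcomm (by omega)
      (fun x y => add_pow_of_qcomm_of_primitive (by omega) hq) v hv]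
    simp [hva]
  by_cases h0 : ringChar k = 0
  · exact primitive (by simpa [h0] using hb)
  rw [if_neg h0] at hb
  have hp : (ringChar k).Prime := (CharP.char_is_prime_or_zero k (ringChar k)).resolve_right h0
  by_cases hdvd : ringChar k ∣ a
  · rw [Nat.gcd_eq_right hdvd] at hb
    have hab : a = b * ringChar k := by rw [hb, Nat.div_mul_cancel hdvd]
    have hb0 : b ≠ 0 := by
      rintro rfl
      simp at hab
      omega
    nontriviality R
    have : Fact (ringChar k).Prime := ⟨hp⟩
    have : CharP R (ringChar k) :=
      charP_of_injective_algebraMap (algebraMap k R).injective (ringChar k)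
    rw [hab, pow_mul, sum_pow_of_qcomm hb0
      (fun x y => add_pow_of_qcomm_of_primitive hb0 hq) v hv,
      sum_pow_of_qcomm (q := (1 : k)) h0 _ (fun i => v i ^ b)]
    · simp [← pow_mul, ← hab, hva]
    · intro i j hij
      rw [mul_pow_of_qcomm (pow_mul_of_qcomm (hv i j hij) b), ← pow_mul, pow_mul, hq.pow_eq_one,
        one_pow]
    · intro x y hxy
      exact add_pow_char_of_commute (ringChar k) (by simpa [Commute, SemiconjBy] using hxy)
  · refine primitive ?_
    rw [hb, Nat.Coprime.gcd_eq_one ((hp.coprime_iff_not_dvd.mpr hdvd).symm), Nat.div_one]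

end GaussCoeff

section NormalForm

variable {k : Type*} [Field k] {R : Type*} [Ring R] [Algebra k R] {q : k} {ι : Type*}

/-- The subalgebra generated by all `v i` with `i ≠ j`. -/
def adjoinNe (k : Type*) [Field k] {R : Type*} [Ring R] [Algebra k R] {ι : Type*}
    (v : ι → R) (j : ι) : Subalgebra k R :=
  Algebra.adjoin k (v '' {i | i ≠ j})

lemma mem_adjoinNe {v : ι → R} {i j : ι} (h : i ≠ j) : v i ∈ adjoinNe k v j :=
  Algebra.subset_adjoin ⟨i, h, rfl⟩

lemma exists_mul_eq_mul_of_mem_adjoinNe [LinearOrder ι] (hq : q ≠ 0) {v : ι → R}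
    (hv : ∀ i j, i < j → v i * v j = q • (v j * v i)) (j : ι) {b : R}
    (hb : b ∈ adjoinNe k v j) : ∃ b' ∈ adjoinNe k v j, v j * b = b' * v j := by
  induction hb using Algebra.adjoin_induction with
  | mem x hx =>
    obtain ⟨i, hi, rfl⟩ := hx
    rcases lt_or_gt_of_ne hi with h | h
    · refine ⟨q⁻¹ • v i, Subalgebra.smul_mem _ (mem_adjoinNe hi) _, ?_⟩
      rw [smul_mul_assoc, hv i j h, smul_smul, inv_mul_cancel₀ hq, one_smul]
    · refine ⟨q • v i, Subalgebra.smul_mem _ (mem_adjoinNe hi) _, ?_⟩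
      rw [smul_mul_assoc, hv j i h]
  | algebraMap r =>
    exact ⟨algebraMap k R r, Subalgebra.algebraMap_mem _ r, (Algebra.commutes r _).symm⟩
  | add x y _ _ hx hy =>
    obtain ⟨x', hx', ex⟩ := hx
    obtain ⟨y', hy', ey⟩ := hy
    exact ⟨x' + y', add_mem hx' hy', by rw [mul_add, add_mul, ex, ey]⟩
  | mul x y _ _ hx hy =>
    obtain ⟨x', hx', ex⟩ := hx
    obtain ⟨y', hy', ey⟩ := hy
    exact ⟨x' * y', mul_mem hx' hy', by rw [← mul_assoc, ex, mul_assoc, ey, mul_assoc]⟩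

/-- The elements `∑ t < a, β t * u ^ t` with coefficients `β t` in the subalgebra `B`. -/
def powerSums (B : Subalgebra k R) (u : R) (a : ℕ) : Submodule k R where
  carrier := {x | ∃ β : ℕ → R, (∀ t, β t ∈ B) ∧ x = ∑ t ∈ Finset.range a, β t * u ^ t}
  zero_mem' := ⟨0, fun _ => zero_mem B, by simp⟩
  add_mem' := by
    rintro _ _ ⟨β, hβ, rfl⟩ ⟨γ, hγ, rfl⟩
    exact ⟨β + γ, fun t => add_mem (hβ t) (hγ t), by simp [add_mul, Finset.sum_add_distrib]⟩
  smul_mem' := by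
    rintro r _ ⟨β, hβ, rfl⟩
    exact ⟨r • β, fun t => B.smul_mem (hβ t) r, by simp [Finset.smul_sum]⟩

lemma mul_mem_powerSums {B : Subalgebra k R} {u : R} {a : ℕ} {b x : R} (hb : b ∈ B)
    (hx : x ∈ powerSums B u a) : b * x ∈ powerSums B u a := by
  obtain ⟨β, hβ, rfl⟩ := hx
  exact ⟨fun t => b * β t, fun t => mul_mem hb (hβ t), by simp [Finset.mul_sum, mul_assoc]⟩

lemma mul_pow_mem_powerSums {B : Subalgebra k R} {u : R} {a : ℕ} (hu : u ^ a = 0) {b : R}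
    (hb : b ∈ B) (t : ℕ) : b * u ^ t ∈ powerSums B u a := by
  by_cases ht : t < a
  · refine ⟨Pi.single t b, fun s => ?_, ?_⟩
    · by_cases h : s = t
      · subst h
        simpa using hb
      · simp [h, zero_mem]
    · rw [Finset.sum_eq_single t]
      · simp
      · intro s _ h
        simp [h]
      · simp [ht]
  · rw [pow_eq_zero_of_le (not_lt.mp ht) hu, mul_zero]
    exact zero_mem _

lemma generator_mul_mem_powerSums [LinearOrder ι] [Fintype ι] (hq : q ≠ 0) {v : ι → R}
    (hv : ∀ i j, i < j → v i * v j = q • (v j * v i)) {lam : ι → k} {j : ι} (hj : lam j ≠ 0)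
    {a : ℕ} (hu : (∑ i, lam i • v i) ^ a = 0) (i : ι) {x : R}
    (hx : x ∈ powerSums (adjoinNe k v j) (∑ i, lam i • v i) a) :
    v i * x ∈ powerSums (adjoinNe k v j) (∑ i, lam i • v i) a := by
  by_cases hij : i ≠ j
  · exact mul_mem_powerSums (mem_adjoinNe hij) hx
  obtain rfl : i = j := not_not.mp hij
  set u := ∑ i, lam i • v i with hu_def
  have hw : u - lam i • v i ∈ adjoinNe k v i := by
    rw [hu_def, ← Finset.add_sum_erase _ _ (Finset.mem_univ i), add_sub_cancel_left]
    exact sum_mem fun l hl => Subalgebra.smul_mem _ (mem_adjoinNe (Finset.ne_of_mem_erase hl)) _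
  have hvi : v i = (lam i)⁻¹ • (u - (u - lam i • v i)) := by
    rw [sub_sub_cancel, smul_smul, inv_mul_cancel₀ hj, one_smul]
  obtain ⟨β, hβ, rfl⟩ := hx
  rw [Finset.mul_sum]
  refine sum_mem fun t _ => ?_
  obtain ⟨b', hb', e⟩ := exists_mul_eq_mul_of_mem_adjoinNe hq hv i (hβ t)
  rw [← mul_assoc, e, hvi, mul_smul_comm, smul_mul_assoc, mul_sub, sub_mul]
  refine Submodule.smul_mem _ _ (sub_mem ?_ ?_)
  · rw [mul_assoc, ← pow_succ']
    exact mul_pow_mem_powerSums hu hb' _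
  · exact mul_pow_mem_powerSums hu (mul_mem hb' hw) _

end NormalForm

section TruncatedShift

variable {k : Type*} [Field k] {R : Type*} [Ring R] [Algebra k R]

/-- The shift operator on sequences, truncated to the positions below `a`. -/
def truncShift (k R : Type*) [Field k] [Ring R] [Algebra k R] (a : ℕ) :
    Module.End k (ℕ → R) where
  toFun f n := Nat.casesOn n 0 fun n => if n + 1 < a then f n else 0
  map_add' f g := by
    ext n
    cases n with
    | zero => simp
    | succ n => by_cases h : n + 1 < a <;> simp [h]
  map_smul' r f := by
    ext n
    cases n with
    | zero => simp
    | succ n => by_cases h : n + 1 < a <;> simp [h]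

/-- Left multiplication by `x` on sequences, twisted by `s ^ (n + e)` at position `n`. -/
def twistedMul (s : k) (e : ℕ) (x : R) : Module.End k (ℕ → R) where
  toFun f n := s ^ (n + e) • (x * f n)
  map_add' f g := by
    ext n
    simp [mul_add]
  map_smul' r f := by
    ext n
    simp [smul_comm r]

lemma truncShift_zero (a : ℕ) (f : ℕ → R) : truncShift k R a f 0 = 0 := rfl

lemma truncShift_succ (a : ℕ) (f : ℕ → R) (n : ℕ) :
    truncShift k R a f (n + 1) = if n + 1 < a then f n else 0 := rfl

lemma twistedMul_apply (s : k) (e : ℕ) (x : R) (f : ℕ → R) (n : ℕ) :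
    twistedMul s e x f n = s ^ (n + e) • (x * f n) := rfl

lemma truncShift_pow_of_lt (a m : ℕ) (f : ℕ → R) {n : ℕ} (h : n < m) :
    (truncShift k R a ^ m) f n = 0 := by
  induction m generalizing n with
  | zero => omega
  | succ m ih =>
    rw [pow_succ', Module.End.mul_apply]
    cases n with
    | zero => rfl
    | succ n =>
      rw [truncShift_succ, ih (by omega), ite_self]

lemma truncShift_pow_self {a : ℕ} (ha : a ≠ 0) : truncShift k R a ^ a = 0 := by
  ext f n
  by_cases h : n < a
  · exact truncShift_pow_of_lt a a f h
  · obtain ⟨m, hm⟩ := Nat.exists_eq_succ_of_ne_zero ha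
    obtain ⟨l, rfl⟩ := Nat.exists_eq_succ_of_ne_zero (n := n) (by omega)
    have : (truncShift k R a ^ (m + 1)) f (l + 1) = 0 := by
      rw [pow_succ', Module.End.mul_apply, truncShift_succ, if_neg h]
    rwa [← Nat.succ_eq_add_one m, ← hm] at this

lemma twistedMul_pow (s : k) (e : ℕ) (x : R) (m : ℕ) (f : ℕ → R) (n : ℕ) :
    (twistedMul s e x ^ m) f n = (s ^ (n + e)) ^ m • (x ^ m * f n) := by
  induction m with
  | zero => simp
  | succ m ih =>
    rw [pow_succ', Module.End.mul_apply, twistedMul_apply, ih, mul_smul_comm, smul_smul,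
      ← mul_assoc, ← pow_succ', ← pow_succ']

end TruncatedShift

section QCI

variable {k : Type} [Field k] {c a : ℕ} {q : k}

lemma Xgen_mul_Xgen {i j : Fin c} (h : i < j) :
    Xgen k c a q i * Xgen k c a q j = q • (Xgen k c a q j * Xgen k c a q i) := by
  have := RingQuot.mkAlgHom_rel k (QCIRel.comm (k := k) (a := a) (q := q) i j h)
  simpa only [map_mul, map_smul, Xgen] using this

lemma Xgen_pow (i : Fin c) : Xgen k c a q i ^ a = 0 := by
  have := RingQuot.mkAlgHom_rel k (QCIRel.pow (k := k) (a := a) (q := q) i)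
  simpa only [map_pow, map_zero, Xgen] using this

/-- Induction principle: a subspace containing `1` and stable under left multiplication by the
generators is everything. -/
lemma QCI.mem_of_generator_mul_mem (S : Submodule k (QCI k c a q)) (h1 : 1 ∈ S)
    (hS : ∀ i, ∀ x ∈ S, Xgen k c a q i * x ∈ S) (x : QCI k c a q) : x ∈ S := by
  obtain ⟨z, rfl⟩ := RingQuot.mkAlgHom_surjective k (QCIRel k c a q) x
  suffices h : ∀ y ∈ S, RingQuot.mkAlgHom k (QCIRel k c a q) z * y ∈ S by
    simpa using h 1 h1
  induction z using FreeAlgebra.induction with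
  | grade0 r =>
    intro y hy
    rw [AlgHom.commutes, ← Algebra.smul_def]
    exact S.smul_mem r hy
  | grade1 i => exact hS i
  | mul z w hz hw =>
    intro y hy
    rw [map_mul, mul_assoc]
    exact hz _ (hw _ hy)
  | add z w hz hw =>
    intro y hy
    rw [map_add, add_mul]
    exact S.add_mem (hz _ hy) (hw _ hy)

/-- The representation on sequences in which `x_j` acts by the truncated shift and the other
generators by twisted multiplications. -/
lemma QCI.exists_shift_representation (ha : a ≠ 0) (hq : q ≠ 0) (j : Fin c) (e : ℕ) :
    ∃ ρ : QCI k c a q →ₐ[k] Module.End k (ℕ → QCI k c a q),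
      ρ (Xgen k c a q j) = truncShift k (QCI k c a q) a ∧
      ∀ i, i ≠ j →
        ρ (Xgen k c a q i) = twistedMul (if i < j then q else q⁻¹) e (Xgen k c a q i) := by
  let F : FreeAlgebra k (Fin c) →ₐ[k] Module.End k (ℕ → QCI k c a q) :=
    FreeAlgebra.lift k fun i => if i = j then truncShift k (QCI k c a q) a
      else twistedMul (if i < j then q else q⁻¹) e (Xgen k c a q i)
  have hFj : F (FreeAlgebra.ι k j) = truncShift k (QCI k c a q) a := by
    simp [F]
  have hF : ∀ i, i ≠ j → F (FreeAlgebra.ι k i) =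
      twistedMul (if i < j then q else q⁻¹) e (Xgen k c a q i) := by
    intro i hi
    simp [F, hi]
  have hrel : ∀ ⦃x y⦄, QCIRel k c a q x y → F x = F y := by
    intro x y hxy
    induction hxy with
    | pow i =>
      rw [map_pow, map_zero]
      by_cases hi : i = j
      · subst hi
        rw [hFj, truncShift_pow_self ha]
      · rw [hF i hi]
        refine LinearMap.ext fun f => funext fun n => ?_
        rw [twistedMul_pow, Xgen_pow, zero_mul, smul_zero]
        rfl
    | comm i l hil =>
      rw [map_mul, map_smul, map_mul]
      refine LinearMap.ext fun f => funext fun n => ?_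
      rw [Module.End.mul_apply, LinearMap.smul_apply, Pi.smul_apply, Module.End.mul_apply]
      by_cases hi : i = j
      · subst hi
        rw [hFj, hF l hil.ne', if_neg hil.not_gt]
        cases n with
        | zero => simp [truncShift_zero, twistedMul_apply]
        | succ n =>
          by_cases hn : n + 1 < a
          · rw [truncShift_succ, twistedMul_apply, twistedMul_apply, truncShift_succ, if_pos hn,
              if_pos hn, smul_smul, add_right_comm n 1 e, pow_succ', mul_inv_cancel_left₀ hq]
          · simp [truncShift_succ, twistedMul_apply, hn]
      · by_cases hl : l = j
        · subst hl
          rw [hFj, hF i hi, if_pos hil]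
          cases n with
          | zero => simp [truncShift_zero, twistedMul_apply]
          | succ n =>
            by_cases hn : n + 1 < a
            · rw [truncShift_succ, twistedMul_apply, twistedMul_apply, truncShift_succ, if_pos hn,
                if_pos hn, smul_smul, add_right_comm n 1 e, pow_succ']
            · simp [truncShift_succ, twistedMul_apply, hn]
        · rw [hF i hi, hF l hl]
          simp only [twistedMul_apply, mul_smul_comm, ← mul_assoc, Xgen_mul_Xgen hil,
            smul_mul_assoc, smul_smul]
          congr 1
          ring
  refine ⟨RingQuot.liftAlgHom k ⟨F, hrel⟩, ?_, fun i hi => ?_⟩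
  · rw [Xgen, RingQuot.liftAlgHom_mkAlgHom_apply, hFj]
  · rw [Xgen, RingQuot.liftAlgHom_mkAlgHom_apply, hF i hi, Xgen]

/-- The coefficient of `u ^ T` in left normal form, up to a power of `λ_j` and modulo higher powers
of `u`. -/
lemma QCI.exists_coeff (hq : q ≠ 0) (hqa : q ^ a = 1) {lam : Fin c → k} (j : Fin c) {T : ℕ}
    (hT : T < a) :
    ∃ C : QCI k c a q →ₗ[k] QCI k c a q, ∀ b ∈ adjoinNe k (Xgen k c a q) j,
      (∀ t < T, C (b * uElt k c a q lam ^ t) = 0) ∧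
      C (b * uElt k c a q lam ^ T) = lam j ^ T • b := by
  obtain ⟨ρ, hρj, hρ⟩ := QCI.exists_shift_representation (c := c) (a := a) (by omega) hq j (a - T)
  have hu : ∀ f n, ρ (uElt k c a q lam) f n =
      lam j • truncShift k (QCI k c a q) a f n + ∑ i ∈ Finset.univ.erase j,
        lam i • twistedMul (if i < j then q else q⁻¹) (a - T) (Xgen k c a q i) f n := by
    intro f n
    rw [uElt, map_sum, LinearMap.sum_apply, Finset.sum_apply,
      ← Finset.add_sum_erase _ _ (Finset.mem_univ j)]
    congr 1
    · rw [map_smul, hρj]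
      rfl
    · refine Finset.sum_congr rfl fun i hi => ?_
      rw [map_smul, hρ i (Finset.ne_of_mem_erase hi)]
      rfl
  have hupow : ∀ t, (∀ n, t < n → ρ (uElt k c a q lam ^ t) (Pi.single 0 1) n = 0) ∧
      (t < a → ρ (uElt k c a q lam ^ t) (Pi.single 0 1) t = lam j ^ t • 1) := by
    intro t
    induction t with
    | zero =>
      refine ⟨fun n hn => ?_, fun _ => by simp⟩
      rw [pow_zero, map_one, Module.End.one_apply, Pi.single_eq_of_ne (by omega)]
    | succ t ih =>
      have step : ∀ n, t ≤ n → ρ (uElt k c a q lam ^ (t + 1)) (Pi.single 0 1) (n + 1) =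
          lam j • if n + 1 < a then ρ (uElt k c a q lam ^ t) (Pi.single 0 1) n else 0 := by
        intro n hn
        rw [pow_succ', map_mul, Module.End.mul_apply, hu, truncShift_succ]
        simp only [twistedMul_apply, ih.1 (n + 1) (by omega), mul_zero, smul_zero,
          Finset.sum_const_zero, add_zero]
      constructor
      · intro n hn
        obtain ⟨m, rfl⟩ := Nat.exists_eq_succ_of_ne_zero (n := n) (by omega)
        rw [step m (by omega), ih.1 m (by omega), ite_self, smul_zero]
      · intro ht
        rw [step t le_rfl, if_pos ht, ih.2 (by omega), smul_smul, pow_succ']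
  have hB : ∀ b ∈ adjoinNe k (Xgen k c a q) j, ∀ f, ρ b f T = b * f T := by
    intro b hb
    induction hb using Algebra.adjoin_induction with
    | mem x hx =>
      obtain ⟨i, hi, rfl⟩ := hx
      intro f
      rw [hρ i hi, twistedMul_apply, Nat.add_sub_cancel' hT.le]
      split_ifs <;> simp [hqa]
    | algebraMap r =>
      intro f
      rw [AlgHom.commutes, Module.algebraMap_end_apply, Pi.smul_apply, Algebra.smul_def]
    | add x y _ _ hx hy =>
      intro f
      rw [map_add, LinearMap.add_apply, Pi.add_apply, hx, hy, add_mul]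
    | mul x y _ _ hx hy =>
      intro f
      rw [map_mul, Module.End.mul_apply, hx, hy, mul_assoc]
  refine ⟨LinearMap.proj T ∘ₗ LinearMap.applyₗ (Pi.single 0 1) ∘ₗ ρ.toLinearMap,
    fun b hb => ?_⟩
  have hC : ∀ t, (LinearMap.proj T ∘ₗ LinearMap.applyₗ (Pi.single 0 1) ∘ₗ ρ.toLinearMap)
      (b * uElt k c a q lam ^ t) = b * ρ (uElt k c a q lam ^ t) (Pi.single 0 1) T := by
    intro t
    change ρ (b * uElt k c a q lam ^ t) (Pi.single 0 1) T = _
    rw [map_mul, Module.End.mul_apply, hB b hb]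
  refine ⟨fun t ht => ?_, ?_⟩
  · rw [hC, (hupow t).1 T ht, mul_zero]
  · rw [hC, (hupow T).2 hT, mul_smul_comm, mul_one]

lemma QCI.coeff_eq_zero (hq : q ≠ 0) (hqa : q ^ a = 1) {lam : Fin c → k} {j : Fin c}
    (hj : lam j ≠ 0) {β : ℕ → QCI k c a q} (hβ : ∀ t, β t ∈ adjoinNe k (Xgen k c a q) j)
    (i m : ℕ) (hm : m + i ≤ a)
    (h : ∑ t ∈ Finset.range m, β t * uElt k c a q lam ^ (t + i) = 0) : ∀ t < m, β t = 0 := by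
  induction m with
  | zero => simp
  | succ m ih =>
    obtain ⟨C, hC⟩ := QCI.exists_coeff hq hqa (lam := lam) j (T := m + i) (by omega)
    have hm0 : β m = 0 := by
      have h' := congrArg C h
      rw [map_zero, map_sum, Finset.sum_range_succ, (hC _ (hβ m)).2,
        Finset.sum_eq_zero fun t ht => (hC _ (hβ t)).1 _
          (by have := Finset.mem_range.mp ht; omega), zero_add] at h'
      exact (smul_eq_zero.mp h').resolve_left (pow_ne_zero _ hj)
    rw [Finset.sum_range_succ, hm0, zero_mul, add_zero] at h
    intro t ht
    rcases Nat.lt_succ_iff_lt_or_eq.mp ht with ht | rfl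
    · exact ih (by omega) h t ht
    · exact hm0

/-- If `u ^ a = 0`, every left annihilator of a power of `u` is generated by the complementary
power. -/
lemma QCI.mul_uElt_pow_eq_zero_iff (hq : q ≠ 0) (hqa : q ^ a = 1) {lam : Fin c → k}
    (hlam : lam ≠ 0) (hu : uElt k c a q lam ^ a = 0) {i : ℕ} (hi : i ≤ a) (x : QCI k c a q) :
    x * uElt k c a q lam ^ i = 0 ↔ ∃ y, y * uElt k c a q lam ^ (a - i) = x := by
  constructor
  · intro hx
    obtain ⟨j, hj⟩ := Function.ne_iff.mp hlam
    have hmem : x ∈ powerSums (adjoinNe k (Xgen k c a q) j) (uElt k c a q lam) a := by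
      refine QCI.mem_of_generator_mul_mem _ ?_ (fun l y hy => ?_) x
      · simpa using mul_pow_mem_powerSums hu (one_mem (adjoinNe k (Xgen k c a q) j)) 0
      · exact generator_mul_mem_powerSums hq (fun _ _ => Xgen_mul_Xgen) hj hu l hy
    obtain ⟨β, hβ, rfl⟩ := hmem
    have hsplit : ∀ f : ℕ → QCI k c a q, ∑ t ∈ Finset.range a, f t =
        ∑ t ∈ Finset.range (a - i), f t + ∑ s ∈ Finset.range i, f (a - i + s) := by
      intro f
      rw [← Finset.sum_range_add, Nat.sub_add_cancel hi]
    have hlow : ∑ t ∈ Finset.range (a - i), β t * uElt k c a q lam ^ (t + i) = 0 := by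
      rw [Finset.sum_mul, hsplit, Finset.sum_eq_zero (s := Finset.range i), add_zero] at hx
      · simpa only [mul_assoc, ← pow_add] using hx
      · intro s _
        rw [mul_assoc, ← pow_add, pow_eq_zero_of_le (by omega) hu, mul_zero]
    have hβ0 := QCI.coeff_eq_zero hq hqa hj hβ i (a - i) (by omega) hlow
    refine ⟨∑ s ∈ Finset.range i, β (a - i + s) * uElt k c a q lam ^ s, ?_⟩
    rw [hsplit, Finset.sum_eq_zero (s := Finset.range (a - i))
      fun t ht => by rw [hβ0 t (Finset.mem_range.mp ht), zero_mul], zero_add, Finset.sum_mul]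
    exact Finset.sum_congr rfl fun s _ => by rw [mul_assoc, ← pow_add, add_comm s]
  · rintro ⟨y, rfl⟩
    rw [mul_assoc, ← pow_add, Nat.sub_add_cancel hi, hu, mul_zero]

end QCI

/-- for every nonzero `λ ∈ k^c` and every `0 ≤ i ≤ a`, the left annihilator
of `u_λ^i` in `A` (the kernel of the `A`-linear map `x ↦ x u_λ^i`) equals the left ideal
`A u_λ^{a-i}` (the range of `x ↦ x u_λ^{a-i}`).  In particular the annihilator of `u_λ` is
`A u_λ^{a-1}` and the annihilator of `u_λ^{a-1}` is `A u_λ`, so the maps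
`⋯ → A → A → A`, alternating right multiplication by `u_λ` and by `u_λ^{a-1}`, are exact:
the left `A`-module `A u_λ` admits a periodic projective (free) resolution of period `2`
with all terms equal to `A`. -/
theorem statement7 (k : Type) [Field k] [IsAlgClosed k] (c a : ℕ) (hc : 2 ≤ c) (ha : 2 ≤ a)
    (b : ℕ) (hb : b = if ringChar k = 0 then a else a / Nat.gcd a (ringChar k))
    (q : k) (hq : IsPrimitiveRoot q b) (lam : Fin c → k) (hlam : lam ≠ 0) :
    letI A := QCI k c a q
    letI u := uElt k c a q lam
    (∀ i : ℕ, i ≤ a →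
      LinearMap.ker (LinearMap.toSpanSingleton A A (u ^ i)) =
        LinearMap.range (LinearMap.toSpanSingleton A A (u ^ (a - i)))) ∧
    LinearMap.ker (LinearMap.toSpanSingleton A A u) =
      LinearMap.range (LinearMap.toSpanSingleton A A (u ^ (a - 1))) ∧
    LinearMap.ker (LinearMap.toSpanSingleton A A (u ^ (a - 1))) =
      LinearMap.range (LinearMap.toSpanSingleton A A u) ∧
    Function.Exact (LinearMap.toSpanSingleton A A u)
      (LinearMap.toSpanSingleton A A (u ^ (a - 1))) ∧
    Function.Exact (LinearMap.toSpanSingleton A A (u ^ (a - 1)))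
      (LinearMap.toSpanSingleton A A u) := by
  have hqa : q ^ a = 1 := by
    refine (hq.pow_eq_one_iff_dvd a).mpr ?_
    rw [hb]
    split_ifs
    · exact dvd_rfl
    · exact Nat.div_dvd_of_dvd (Nat.gcd_dvd_left _ _)
  have hq0 : q ≠ 0 := by
    rintro rfl
    rw [zero_pow (by omega)] at hqa
    exact zero_ne_one hqa
  have hu : uElt k c a q lam ^ a = 0 := by
    refine sum_pow_eq_zero_of_qcomm ha hb hq _ (fun i j hij => ?_) fun i => ?_
    · rw [smul_mul_smul_comm, Xgen_mul_Xgen hij, smul_mul_smul_comm, smul_comm,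
        mul_comm (lam i)]
    · rw [smul_pow, Xgen_pow, smul_zero]
  have key : ∀ i : ℕ, i ≤ a →
      LinearMap.ker (LinearMap.toSpanSingleton (QCI k c a q) (QCI k c a q)
        (uElt k c a q lam ^ i)) =
      LinearMap.range (LinearMap.toSpanSingleton (QCI k c a q) (QCI k c a q)
        (uElt k c a q lam ^ (a - i))) := by
    intro i hi
    ext x
    exact QCI.mul_uElt_pow_eq_zero_iff hq0 hqa hlam hu hi x
  have key_one := key 1 (by omega)
  have key_sub := key (a - 1) (by omega)
  rw [pow_one] at key_one
  rw [Nat.sub_sub_self (by omega), pow_one] at key_sub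
  exact ⟨key, key_one, key_sub, LinearMap.exact_iff.mpr key_sub, LinearMap.exact_iff.mpr key_one⟩
end
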